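/- Let G be the group of order 16 with presentation ⟨x, y, z | x⁴ = y² = z² = 1, [x,y] = 1, [y,z] = 1, z⁻¹xz = xy⟩. Then the element x²yz has order 2, the elements xyz and x³z each have order 4, the product (x²yz)·(x²yz)·(xyz)·(x³z) equals the identity, and the set {x²yz, xyz, x³z} generates G. (These data realize the ramification type (2², 4²) of the covering C₂ → ℙ¹ with Galois group G(16).) -/

import Mathlib

namespace G16Pres

/-- Relators of ⟨x,y,z ∣ x⁴ = y² = z² = 1, [x,y] = 1, [y,z] = 1, z⁻¹xz = xy⟩. -/
def rels : Set (FreeGroup (Fin 3)) :=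
  {FreeGroup.of 0 ^ 4, FreeGroup.of 1 ^ 2, FreeGroup.of 2 ^ 2,
   FreeGroup.of 0 * FreeGroup.of 1 * (FreeGroup.of 0)⁻¹ * (FreeGroup.of 1)⁻¹,
   FreeGroup.of 1 * FreeGroup.of 2 * (FreeGroup.of 1)⁻¹ * (FreeGroup.of 2)⁻¹,
   ((FreeGroup.of 2)⁻¹ * FreeGroup.of 0 * FreeGroup.of 2) *
     (FreeGroup.of 0 * FreeGroup.of 1)⁻¹}

/-- The group G(16) with presentation
⟨x,y,z ∣ x⁴ = y² = z² = 1, [x,y] = [y,z] = 1, z⁻¹xz = xy⟩. -/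
abbrev G : Type := PresentedGroup rels

def x : G := PresentedGroup.of 0
def y : G := PresentedGroup.of 1
def z : G := PresentedGroup.of 2

end G16Pres

namespace G16Pres

/-- Exponent triples `(a, b, c)`, standing for the normal form `x ^ a * y ^ b * z ^ c`. -/
abbrev Exps : Type := ZMod 4 × ZMod 2 × ZMod 2

/-- Left multiplication by `x`, `y`, `z` on normal forms. -/
def genPerm : Fin 3 → Equiv.Perm Exps :=
  ![Equiv.addLeft (1, 0, 0), Equiv.addLeft (0, 1, 0),
    Function.Involutive.toPerm (fun p => (p.1, p.2.1 + (p.1.val : ZMod 2), p.2.2 + 1))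
      (by unfold Function.Involutive; decide)]

lemma lift_genPerm_eq_one : ∀ r ∈ rels, FreeGroup.lift genPerm r = 1 := by
  rintro r (rfl | rfl | rfl | rfl | rfl | rfl) <;>
    simp only [map_mul, map_pow, map_inv, FreeGroup.lift_apply_of] <;>
    ext1 p <;> revert p <;> decide

/-- The permutation action of `G` on normal forms. -/
def toPerm : G →* Equiv.Perm Exps := PresentedGroup.toGroup lift_genPerm_eq_one

lemma toPerm_of (i : Fin 3) : toPerm (PresentedGroup.of i) = genPerm i :=
  PresentedGroup.toGroup.of lift_genPerm_eq_one

lemma toPerm_x : toPerm x = genPerm 0 := toPerm_of 0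

lemma toPerm_y : toPerm y = genPerm 1 := toPerm_of 1

lemma toPerm_z : toPerm z = genPerm 2 := toPerm_of 2

lemma x_pow_four : x ^ 4 = 1 :=
  PresentedGroup.one_of_mem (rels := rels) (x := FreeGroup.of 0 ^ 4) (by simp [rels])

lemma y_pow_two : y ^ 2 = 1 :=
  PresentedGroup.one_of_mem (rels := rels) (x := FreeGroup.of 1 ^ 2) (by simp [rels])

lemma z_pow_two : z ^ 2 = 1 :=
  PresentedGroup.one_of_mem (rels := rels) (x := FreeGroup.of 2 ^ 2) (by simp [rels])

lemma commute_x_y : Commute x y := by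
  have h : x * y * x⁻¹ * y⁻¹ = 1 :=
    PresentedGroup.one_of_mem (rels := rels)
      (x := FreeGroup.of 0 * FreeGroup.of 1 * (FreeGroup.of 0)⁻¹ * (FreeGroup.of 1)⁻¹)
      (by simp [rels])
  exact commutatorElement_eq_one_iff_commute.mp h

lemma commute_y_z : Commute y z := by
  have h : y * z * y⁻¹ * z⁻¹ = 1 :=
    PresentedGroup.one_of_mem (rels := rels)
      (x := FreeGroup.of 1 * FreeGroup.of 2 * (FreeGroup.of 1)⁻¹ * (FreeGroup.of 2)⁻¹)
      (by simp [rels])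
  exact commutatorElement_eq_one_iff_commute.mp h

lemma z_mul_x : z * x = x * y * z := by
  have h : (z⁻¹ * x * z) * (x * y)⁻¹ = 1 :=
    PresentedGroup.one_of_mem (rels := rels)
      (x := ((FreeGroup.of 2)⁻¹ * FreeGroup.of 0 * FreeGroup.of 2) *
        (FreeGroup.of 0 * FreeGroup.of 1)⁻¹) (by simp [rels])
  have hz : z⁻¹ = z := inv_eq_of_mul_eq_one_left (by rw [← pow_two, z_pow_two])
  rw [mul_inv_eq_one, hz] at h
  rw [← h, mul_assoc _ z z, ← pow_two, z_pow_two, mul_one]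

lemma z_mul_x_pow (n : ℕ) : z * x ^ n = x ^ n * y ^ n * z := by
  induction n with
  | zero => simp
  | succ n ih =>
    calc z * x ^ (n + 1) = x ^ n * y ^ n * (z * x) := by
          rw [pow_succ, ← mul_assoc, ih, mul_assoc]
      _ = x ^ n * (y ^ n * x) * y * z := by rw [z_mul_x]; group
      _ = x ^ (n + 1) * y ^ (n + 1) * z := by
          rw [(commute_x_y.pow_right n).eq.symm]; group

/-- The element of `G` with the given exponents. -/
def ofExps (p : Exps) : G := x ^ p.1.val * y ^ p.2.1.val * z ^ p.2.2.val

lemma pow_val_add {M : Type*} [Monoid M] {n : ℕ} [NeZero n] {g : M} (hg : g ^ n = 1)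
    (a b : ZMod n) : g ^ (a + b).val = g ^ a.val * g ^ b.val := by
  rw [ZMod.val_add, ← pow_eq_pow_mod _ hg, pow_add]

lemma ofExps_genPerm (i : Fin 3) (p : Exps) :
    ofExps (genPerm i p) = PresentedGroup.of i * ofExps p := by
  obtain ⟨a, b, c⟩ := p
  fin_cases i
  · change x ^ (1 + a).val * y ^ (0 + b).val * z ^ (0 + c).val =
      x * (x ^ a.val * y ^ b.val * z ^ c.val)
    rw [pow_val_add x_pow_four, zero_add, zero_add, show (1 : ZMod 4).val = 1 from rfl, pow_one]
    simp only [mul_assoc]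
  · change x ^ (0 + a).val * y ^ (1 + b).val * z ^ (0 + c).val =
      y * (x ^ a.val * y ^ b.val * z ^ c.val)
    rw [pow_val_add y_pow_two, zero_add, zero_add, show (1 : ZMod 2).val = 1 from rfl, pow_one,
      ← mul_assoc, (commute_x_y.pow_left _).eq]
    simp only [mul_assoc]
  · change x ^ a.val * y ^ (b + (a.val : ZMod 2)).val * z ^ (c + 1).val =
      z * (x ^ a.val * y ^ b.val * z ^ c.val)
    rw [pow_val_add y_pow_two, add_comm c, pow_val_add z_pow_two, ZMod.val_natCast,
      ← pow_eq_pow_mod _ y_pow_two, show (1 : ZMod 2).val = 1 from rfl, pow_one,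
      ← mul_assoc z, ← mul_assoc z, z_mul_x_pow, mul_assoc _ z,
      ← (commute_y_z.pow_left _).eq, (Commute.pow_pow_self y _ _).eq]
    simp only [mul_assoc]

lemma ofExps_toPerm (g : G) (p : Exps) : ofExps (toPerm g p) = g * ofExps p := by
  have hg : g ∈ Subgroup.closure (Set.range (PresentedGroup.of (rels := rels))) := by
    simp
  induction hg using Subgroup.closure_induction generalizing p with
  | mem g hg =>
    obtain ⟨i, rfl⟩ := hg
    rw [toPerm_of, ofExps_genPerm]
  | one => simp
  | mul g h _ _ ihg ihh => rw [map_mul, Equiv.Perm.mul_apply, ihg, ihh, mul_assoc]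
  | inv g _ ih =>
    rw [eq_inv_mul_iff_mul_eq, ← ih, ← Equiv.Perm.mul_apply, ← map_mul, mul_inv_cancel, map_one,
      Equiv.Perm.one_apply]

lemma toPerm_ofExps (p : Exps) : toPerm (ofExps p) 0 = p := by
  simp only [ofExps, map_mul, map_pow, toPerm_x, toPerm_y, toPerm_z]
  revert p
  decide

/-- Every element of `G` has a unique normal form. -/
def equivExps : G ≃ Exps where
  toFun g := toPerm g 0
  invFun := ofExps
  left_inv g := by rw [ofExps_toPerm]; simp [ofExps]
  right_inv := toPerm_ofExps

lemma card_G : Nat.card G = 16 := by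
  rw [Nat.card_congr equivExps]
  simp

/-- Words in `x`, `y`, `z` are compared by evaluating them on the trivial normal form. -/
lemma eq_iff_toPerm_zero {g h : G} : g = h ↔ toPerm g 0 = toPerm h 0 :=
  equivExps.injective.eq_iff.symm

end G16Pres

open G16Pres in
/-- In the group G(16) of order 16, the tuple (x²yz, x²yz, xyz, x³z) has orders
(2,2,4,4), product 1, and {x²yz, xyz, x³z} generates G: it realizes the ramification
type (2²,4²) of the covering C₂ → ℙ¹ with Galois group G(16). -/
theorem G16_ramification_data_C2 :
    Nat.card G = 16 ∧
    orderOf (x ^ 2 * y * z) = 2 ∧ orderOf (x * y * z) = 4 ∧ orderOf (x ^ 3 * z) = 4 ∧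
    (x ^ 2 * y * z) * (x ^ 2 * y * z) * (x * y * z) * (x ^ 3 * z) = 1 ∧
    Subgroup.closure {x ^ 2 * y * z, x * y * z, x ^ 3 * z} = (⊤ : Subgroup G) := by
  refine ⟨card_G, ?_, ?_, ?_, ?_, ?_⟩
  · apply orderOf_eq_prime <;>
      simp only [ne_eq, eq_iff_toPerm_zero, map_mul, map_pow, map_one, toPerm_x, toPerm_y,
        toPerm_z] <;> decide
  · apply orderOf_eq_prime_pow (p := 2) (n := 1) <;>
      simp only [eq_iff_toPerm_zero, map_mul, map_pow, map_one, toPerm_x, toPerm_y,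
        toPerm_z] <;> decide
  · apply orderOf_eq_prime_pow (p := 2) (n := 1) <;>
      simp only [eq_iff_toPerm_zero, map_mul, map_pow, map_one, toPerm_x, toPerm_z] <;>
        decide
  · simp only [eq_iff_toPerm_zero, map_mul, map_pow, map_one, toPerm_x, toPerm_y, toPerm_z]
    decide
  · set H := Subgroup.closure {x ^ 2 * y * z, x * y * z, x ^ 3 * z}
    have ha : x ^ 2 * y * z ∈ H := Subgroup.subset_closure (by simp)
    have hb : x * y * z ∈ H := Subgroup.subset_closure (by simp)
    have hx : x ∈ H := by
      have h : x = x ^ 2 * y * z * (x * y * z) ^ 3 := by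
        simp only [eq_iff_toPerm_zero, map_mul, map_pow, toPerm_x, toPerm_y, toPerm_z]
        decide
      rw [h]
      exact mul_mem ha (pow_mem hb 3)
    have hy : y ∈ H := by
      have h : y = x ^ 2 * (x * y * z) ^ 2 := by
        simp only [eq_iff_toPerm_zero, map_mul, map_pow, toPerm_x, toPerm_y, toPerm_z]
        decide
      rw [h]
      exact mul_mem (pow_mem hx 2) (pow_mem hb 2)
    have hz : z ∈ H := (H.mul_mem_cancel_left (mul_mem hx hy)).mp hb
    rw [eq_top_iff, ← PresentedGroup.closure_range_of rels, Subgroup.closure_le]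
    rintro _ ⟨i, rfl⟩
    fin_cases i
    exacts [hx, hy, hz]
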